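/- Let $A$ be a real $m \times n$ matrix with columns $A_{\cdot i}$, let $b \in \mathbb{R}^m$, and $\gamma > 0$. Suppose $x \ne 0$ is a local minimizer of $F(y) = \gamma \|y\|_1/\|y\|_2 + \tfrac12 \|A y - b\|_2^2$ on $\mathbb{R}^n \setminus \{0\}$. Set $a = \|x\|_1$, $r = \|x\|_2$, and for $i$ with $x_i \ne 0$ set $\tilde{\delta}_i = \|A_{\cdot i}\|_2^2/\gamma$, $\Delta_i = \dfrac{4}{r^6} + \dfrac{12 a^2}{r^8} - \dfrac{12 a \tilde{\delta}_i}{r^5}$, $\kappa_{1,i} = \dfrac{\frac{2}{r^3} - \sqrt{\Delta_i}}{\frac{6a}{r^5}}$ and $\kappa_{2,i} = \dfrac{\frac{2}{r^3} + \sqrt{\Delta_i}}{\frac{6a}{r^5}}$. Then for every index $i$ with $x_i \ne 0$ satisfying $\dfrac{a}{r^3} < \tilde{\delta}_i < \dfrac{a}{r^3} + \dfrac{1}{3 a r}$, one has $|x_i| \le \kappa_{1,i}$ or $|x_i| \ge \kappa_{2,i}$. -/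

import Mathlib

open Filter Topology in
/-- Second-order necessary condition for a local minimum in one variable. -/
lemma IsLocalMin.second_deriv_nonneg {f f' : ℝ → ℝ} {c x₀ : ℝ} (hmin : IsLocalMin f x₀)
    (hf : ∀ᶠ t in 𝓝 x₀, HasDerivAt f (f' t) t) (hf' : HasDerivAt f' c x₀) : 0 ≤ c := by
  by_contra! hc
  have hd : deriv f =ᶠ[𝓝 x₀] f' := hf.mono fun t ht => ht.deriv
  have hdd : HasDerivAt (deriv f) c x₀ := hf'.congr_of_eventuallyEq hd
  have hmax : IsLocalMax f x₀ :=
    isLocalMax_of_deriv_deriv_neg (by rwa [hdd.deriv]) hmin.deriv_eq_zero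
      hf.self_of_nhds.continuousAt
  have hconst : f =ᶠ[𝓝 x₀] fun _ => f x₀ := by
    filter_upwards [hmin, hmax] with t h₁ h₂ using le_antisymm h₂ h₁
  have hzero : deriv f =ᶠ[𝓝 x₀] fun _ => 0 := by
    simpa using hconst.deriv
  exact hc.ne (hdd.unique ((hasDerivAt_const x₀ (0 : ℝ)).congr_of_eventuallyEq hzero))

lemma sum_comp_update {ι : Type*} [Fintype ι] [DecidableEq ι] (f : ℝ → ℝ) (x : ι → ℝ) (i : ι)
    (v : ℝ) : ∑ j, f (Function.update x i v j) = ∑ j, f (x j) - f (x i) + f v := by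
  rw [← Finset.add_sum_erase _ _ (Finset.mem_univ i),
    ← Finset.add_sum_erase (a := i) _ (fun j => f (x j)) (Finset.mem_univ i),
    Function.update_self]
  have : ∑ j ∈ Finset.univ.erase i, f (Function.update x i v j)
      = ∑ j ∈ Finset.univ.erase i, f (x j) :=
    Finset.sum_congr rfl fun j hj => by rw [Function.update_of_ne (Finset.ne_of_mem_erase hj)]
  rw [this]
  ring

open Filter Topology in
lemma exists_sign_eventually_abs_add {u : ℝ} (hu : u ≠ 0) :
    ∃ s : ℝ, s * u = |u| ∧ ∀ᶠ t in 𝓝 (0 : ℝ), |u + t| = |u| + s * t := by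
  rcases lt_or_gt_of_ne hu with h | h
  · refine ⟨-1, by rw [abs_of_neg h]; ring, ?_⟩
    filter_upwards [gt_mem_nhds (show (0 : ℝ) < -u by linarith)] with t ht
    rw [abs_of_neg h, abs_of_neg (by linarith)]
    ring
  · refine ⟨1, by rw [abs_of_pos h]; ring, ?_⟩
    filter_upwards [lt_mem_nhds (show -u < (0 : ℝ) by linarith)] with t ht
    rw [abs_of_pos h, abs_of_pos (by linarith)]
    ring

/-- The derivative of an affine function over the square root of a monic quadratic. -/
lemma hasDerivAt_affine_div_sqrt (a s u w t : ℝ) (hq : 0 < w + 2 * u * t + t ^ 2) :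
    HasDerivAt (fun t => (a + s * t) / √(w + 2 * u * t + t ^ 2))
      (s / √(w + 2 * u * t + t ^ 2) -
        (a + s * t) * (u + t) / √(w + 2 * u * t + t ^ 2) ^ 3) t := by
  have h₁ : HasDerivAt (fun t => a + s * t) s t := by
    simpa using ((hasDerivAt_id t).const_mul s).const_add a
  have h₂ : HasDerivAt (fun t => w + 2 * u * t + t ^ 2) (2 * u + 2 * t) t := by
    simpa using (((hasDerivAt_id t).const_mul (2 * u)).const_add w).fun_add (hasDerivAt_pow 2 t)
  have hpos := Real.sqrt_pos.2 hq
  refine (h₁.div (h₂.sqrt hq.ne') hpos.ne').congr_deriv ?_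
  field_simp

/-- The second derivative at `0` of an affine function over the square root of a monic
quadratic. -/
lemma hasDerivAt_deriv_affine_div_sqrt (a s u r : ℝ) (hr : 0 < r) :
    HasDerivAt (fun t => s / √(r ^ 2 + 2 * u * t + t ^ 2) -
        (a + s * t) * (u + t) / √(r ^ 2 + 2 * u * t + t ^ 2) ^ 3)
      (3 * a * u ^ 2 / r ^ 5 - 2 * (s * u) / r ^ 3 - a / r ^ 3) 0 := by
  have h₁ : HasDerivAt (fun t => a + s * t) s 0 := by
    simpa using ((hasDerivAt_id (0 : ℝ)).const_mul s).const_add a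
  have h₂ : HasDerivAt (fun t => r ^ 2 + 2 * u * t + t ^ 2) (2 * u) 0 := by
    simpa using (((hasDerivAt_id (0 : ℝ)).const_mul (2 * u)).const_add (r ^ 2)).fun_add
      (hasDerivAt_pow 2 (0 : ℝ))
  have h₃ : HasDerivAt (fun t => u + t) 1 0 := by
    simpa using (hasDerivAt_id (0 : ℝ)).const_add u
  have hq0 : r ^ 2 + 2 * u * 0 + 0 ^ 2 = r ^ 2 := by ring
  have hsqrt : √(r ^ 2 + 2 * u * 0 + 0 ^ 2) = r := by rw [hq0, Real.sqrt_sq hr.le]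
  have h₄ := h₂.sqrt (by rw [hq0]; positivity)
  refine (((hasDerivAt_const (0 : ℝ) s).div h₄ (by rw [hsqrt]; exact hr.ne')).sub
    ((h₁.mul h₃).div (h₄.pow 3) (by simp only [Pi.pow_apply, hsqrt]; positivity))).congr_deriv ?_
  simp only [Pi.pow_apply, Pi.mul_apply, hsqrt]
  field_simp
  ring

/-- The residual sum of squares is quadratic along a coordinate direction. -/
lemma sum_sq_mulVec_update_sub {m n : ℕ} (A : Matrix (Fin m) (Fin n) ℝ) (b : Fin m → ℝ)
    (x : Fin n → ℝ) (i : Fin n) (t : ℝ) :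
    ∑ k, (A.mulVec (Function.update x i (x i + t)) k - b k) ^ 2 =
      ∑ k, (A.mulVec x k - b k) ^ 2 + 2 * (∑ k, (A.mulVec x k - b k) * A k i) * t +
        (∑ k, A k i ^ 2) * t ^ 2 := by
  have h : Function.update x i (x i + t) = x + Pi.single i t := by
    ext j
    by_cases hj : j = i
    · subst hj; simp
    · simp [hj]
  simp only [h, Matrix.mulVec_add, Matrix.mulVec_single, Finset.mul_sum, Finset.sum_mul,
    ← Finset.sum_add_distrib]
  refine Finset.sum_congr rfl fun k _ => ?_
  simp
  ring

open Filter Topology in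
/-- Second-order optimality along a coordinate in the support of a local minimizer. -/
lemma second_order_condition {m n : ℕ} (A : Matrix (Fin m) (Fin n) ℝ)
    (b : Fin m → ℝ) (γ : ℝ) (x : Fin n → ℝ)
    (hloc : IsLocalMinOn
      (fun y : Fin n → ℝ =>
        γ * ((∑ i, |y i|) / Real.sqrt (∑ i, (y i) ^ 2)) +
          (1 / 2) * ∑ k, (A.mulVec y k - b k) ^ 2)
      {y : Fin n → ℝ | y ≠ 0} x)
    (a r : ℝ) (ha : a = ∑ i, |x i|) (hr : r = Real.sqrt (∑ i, (x i) ^ 2)) (hr0 : 0 < r)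
    (i : Fin n) (hi : x i ≠ 0) :
    0 ≤ γ * (3 * a * |x i| ^ 2 / r ^ 5 - 2 * |x i| / r ^ 3 - a / r ^ 3) + ∑ k, A k i ^ 2 := by
  obtain ⟨s, hs, habs⟩ := exists_sign_eventually_abs_add hi
  have hr2 : ∑ j, x j ^ 2 = r ^ 2 := by
    rw [hr, Real.sq_sqrt (Finset.sum_nonneg fun j _ => sq_nonneg _)]
  set D := ∑ k, A k i ^ 2
  set B := ∑ k, (A.mulVec x k - b k) * A k i
  set C := ∑ k, (A.mulVec x k - b k) ^ 2
  let g : ℝ → ℝ := fun t => γ * ((a + s * t) / √(r ^ 2 + 2 * x i * t + t ^ 2)) +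
    1 / 2 * (C + 2 * B * t + D * t ^ 2)
  let p : ℝ → Fin n → ℝ := fun t => Function.update x i (x i + t)
  have hp0 : p 0 = x := by simp [p]
  have hpc : Continuous p := by fun_prop
  have hne : ∀ᶠ t in 𝓝 (0 : ℝ), p t ≠ 0 := by
    have : ContinuousAt (fun t => p t) 0 := hpc.continuousAt
    refine this.eventually_ne ?_
    rw [hp0]
    exact fun h => hi (congrFun h i)
  have htend : Tendsto p (𝓝 0) (𝓝[{y : Fin n → ℝ | y ≠ 0}] x) :=
    tendsto_nhdsWithin_iff.2 ⟨by simpa [hp0] using hpc.tendsto 0, hne⟩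
  have hg : ∀ t, |x i + t| = |x i| + s * t →
      γ * ((∑ j, |p t j|) / √(∑ j, p t j ^ 2)) +
        (1 / 2) * ∑ k, (A.mulVec (p t) k - b k) ^ 2 = g t := by
    intro t ht
    have e₁ : ∑ j, |p t j| = a + s * t := by
      rw [sum_comp_update (fun v => |v|), ht, ← ha]; ring
    have e₂ : ∑ j, p t j ^ 2 = r ^ 2 + 2 * x i * t + t ^ 2 := by
      rw [sum_comp_update (fun v => v ^ 2), hr2]; ring
    rw [e₁, e₂, sum_sq_mulVec_update_sub]
  have hmin : IsLocalMin g 0 := by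
    filter_upwards [htend.eventually hloc, habs] with t ht hat
    have h0 := hg 0 (by simp)
    rw [hp0] at h0
    rw [← h0, ← hg t hat]
    exact ht
  have hq : ∀ᶠ t in 𝓝 (0 : ℝ), 0 < r ^ 2 + 2 * x i * t + t ^ 2 := by
    have hc : ContinuousAt (fun t : ℝ => r ^ 2 + 2 * x i * t + t ^ 2) 0 := by fun_prop
    exact hc.eventually_const_lt (by simpa using pow_pos hr0 2)
  have hderiv : ∀ᶠ t in 𝓝 (0 : ℝ), HasDerivAt g
      (γ * (s / √(r ^ 2 + 2 * x i * t + t ^ 2) -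
        (a + s * t) * (x i + t) / √(r ^ 2 + 2 * x i * t + t ^ 2) ^ 3) + (B + D * t)) t := by
    filter_upwards [hq] with t ht
    refine ((hasDerivAt_affine_div_sqrt a s (x i) (r ^ 2) t ht).const_mul γ).add ?_
    have h := (((((hasDerivAt_id t).const_mul (2 * B)).const_add C).add
      ((hasDerivAt_pow 2 t).const_mul D))).const_mul (1 / 2 : ℝ)
    refine h.congr_deriv ?_
    norm_num
    ring
  have hlin : HasDerivAt (fun t => B + D * t) D 0 := by
    simpa using ((hasDerivAt_id (0 : ℝ)).const_mul D).const_add B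
  have := hmin.second_deriv_nonneg hderiv
    (((hasDerivAt_deriv_affine_div_sqrt a s (x i) r hr0).const_mul γ).add hlin)
  rwa [hs, ← sq_abs (x i)] at this

/-- A quadratic with positive leading coefficient is negative strictly between its roots. -/
lemma le_root_or_root_le {p q c z d : ℝ} (hp : 0 < p) (hd : d = q ^ 2 - 4 * p * c) (hd0 : 0 ≤ d)
    (h : 0 ≤ p * z ^ 2 - q * z + c) :
    z ≤ (q - √d) / (2 * p) ∨ (q + √d) / (2 * p) ≤ z := by
  rw [le_div_iff₀ (by positivity), div_le_iff₀ (by positivity)]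
  by_contra! hz
  have hsq := Real.sq_sqrt hd0
  nlinarith [mul_pos (sub_pos.2 hz.1) (sub_pos.2 hz.2), mul_nonneg hp.le h]


theorem unconstrained_entry_two_sided_bound (m n : ℕ) (A : Matrix (Fin m) (Fin n) ℝ)
    (b : Fin m → ℝ) (γ : ℝ) (hγ : 0 < γ)
    (x : Fin n → ℝ) (hx : x ≠ 0)
    (hloc : IsLocalMinOn
      (fun y : Fin n → ℝ =>
        γ * ((∑ i, |y i|) / Real.sqrt (∑ i, (y i) ^ 2)) +
          (1 / 2) * ∑ k, (A.mulVec y k - b k) ^ 2)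
      {y : Fin n → ℝ | y ≠ 0} x)
    (a r : ℝ) (ha : a = ∑ i, |x i|) (hr : r = Real.sqrt (∑ i, (x i) ^ 2))
    (δt : Fin n → ℝ) (hδt : ∀ i, δt i = (∑ k, (A k i) ^ 2) / γ)
    (Δ : Fin n → ℝ)
    (hΔ : ∀ i, Δ i = 4 / r ^ 6 + 12 * a ^ 2 / r ^ 8 - 12 * a * δt i / r ^ 5)
    (κ₁ κ₂ : Fin n → ℝ)
    (hκ₁ : ∀ i, κ₁ i = (2 / r ^ 3 - Real.sqrt (Δ i)) / (6 * a / r ^ 5))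
    (hκ₂ : ∀ i, κ₂ i = (2 / r ^ 3 + Real.sqrt (Δ i)) / (6 * a / r ^ 5)) :
    ∀ i, x i ≠ 0 → a / r ^ 3 < δt i → δt i < a / r ^ 3 + 1 / (3 * a * r) →
      |x i| ≤ κ₁ i ∨ κ₂ i ≤ |x i| := by
  intro i hi _ hlt
  have hsum : 0 < ∑ j, x j ^ 2 :=
    Finset.sum_pos' (fun j _ => sq_nonneg _) ⟨i, Finset.mem_univ i, by positivity⟩
  have hr0 : 0 < r := hr ▸ Real.sqrt_pos.2 hsum
  have ha0 : 0 < a :=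
    ha ▸ Finset.sum_pos' (fun j _ => abs_nonneg _) ⟨i, Finset.mem_univ i, abs_pos.2 hi⟩
  have hso := second_order_condition A b γ x hloc a r ha hr hr0 i hi
  have hquad : 0 ≤ 3 * a / r ^ 5 * |x i| ^ 2 - 2 / r ^ 3 * |x i| + (δt i - a / r ^ 3) := by
    have hδγ : ∑ k, A k i ^ 2 = γ * δt i := by
      rw [hδt, mul_div_cancel₀ _ hγ.ne']
    rw [hδγ, ← mul_add] at hso
    refine (nonneg_of_mul_nonneg_right hso hγ).trans_eq ?_
    ring
  have hdisc : Δ i = (2 / r ^ 3) ^ 2 - 4 * (3 * a / r ^ 5) * (δt i - a / r ^ 3) := by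
    rw [hΔ]
    field_simp
    ring
  have hdisc0 : 0 ≤ Δ i := by
    have h : 12 * a / r ^ 5 * (δt i - a / r ^ 3) ≤ 12 * a / r ^ 5 * (1 / (3 * a * r)) := by
      gcongr
      linarith
    have h' : 12 * a / r ^ 5 * (1 / (3 * a * r)) = (2 / r ^ 3) ^ 2 := by
      field_simp
      norm_num
    rw [hdisc]
    linear_combination h + h'
  have h2p : 6 * a / r ^ 5 = 2 * (3 * a / r ^ 5) := by ring
  rw [hκ₁, hκ₂, h2p]
  exact le_root_or_root_le (by positivity) hdisc hdisc0 hquad
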